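/- Let k ≥ 0 and let ∼ be the equivalence relation on Δ^{2k} × [0, 2π/(2k+1)] generated by ((a_0,a_1,…,a_{2k}), 0) ∼ ((a_1,…,a_{2k},a_0), 2π/(2k+1)). Then the map from the quotient (Δ^{2k} × [0,2π/(2k+1)])/∼ to P̄_{2k+1} sending [(a_0,…,a_{2k}), θ] to Σ_{j=0}^{2k} a_j δ_{θ+2πj/(2k+1)} is a homeomorphism, and it restricts to a homeomorphism from (∂Δ^{2k} × [0,2π/(2k+1)])/∼ onto ∂P_{2k+1}. -/

import Mathlib

open MeasureTheory Metric Set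
open scoped NNReal ENNReal

noncomputable section

abbrev Circ : Type := AddCircle (2 * Real.pi)

instance : Fact (0 < 2 * Real.pi) := ⟨by positivity⟩

/-- The polygonal measure `Σ_j a_j δ_{θ + 2πj/n}` on the circle `ℝ/2πℤ`. -/
def polyM (n : ℕ) (a : Fin n → ℝ≥0) (θ : ℝ) : Measure Circ :=
  ∑ j : Fin n, (a j : ℝ≥0∞) • Measure.dirac ((θ + 2 * Real.pi * j / n : ℝ) : Circ)

/-- `P̄_{2k+1}`: the space of probability measures of the form `Σ_j a_j δ_{θ+2πj/(2k+1)}`,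
as a subspace of the probability measures on the circle with the topology of weak
convergence. -/
def Pbar (k : ℕ) : Set (ProbabilityMeasure Circ) :=
  {μ | ∃ (a : Fin (2 * k + 1) → ℝ≥0) (θ : ℝ),
    (∑ j, a j = 1) ∧ μ.toMeasure = polyM (2 * k + 1) a θ}

/-- `∂P_{2k+1} ⊆ P̄_{2k+1}`: the measures for which some coefficient vanishes. -/
def PbarBdry (k : ℕ) : Set (ProbabilityMeasure Circ) :=
  {μ | ∃ (a : Fin (2 * k + 1) → ℝ≥0) (θ : ℝ),
    (∑ j, a j = 1) ∧ (∃ j, a j = 0) ∧ μ.toMeasure = polyM (2 * k + 1) a θ}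

/-- The cylinder `Δ^{2k} × [0, 2π/(2k+1)]` over the standard simplex. -/
abbrev SimplexCyl (k : ℕ) : Type :=
  ↥(stdSimplex ℝ (Fin (2 * k + 1))) × ↥(Set.Icc (0 : ℝ) (2 * Real.pi / (2 * k + 1)))

/-- The relation generating the mapping-torus identification:
`((a_0,…,a_{2k}), 0) ∼ ((a_1,…,a_{2k},a_0), 2π/(2k+1))`. -/
def shiftRel (k : ℕ) : SimplexCyl k → SimplexCyl k → Prop := fun p q =>
  (p.2 : ℝ) = 0 ∧ (q.2 : ℝ) = 2 * Real.pi / (2 * k + 1) ∧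
    ∀ j : Fin (2 * k + 1),
      (q.1 : Fin (2 * k + 1) → ℝ) j = (p.1 : Fin (2 * k + 1) → ℝ) (j + 1)

/-- The `j`-th vertex of the regular polygon. -/
def ptM (k : ℕ) (θ : ℝ) (j : Fin (2 * k + 1)) : Circ :=
  ((θ + 2 * Real.pi * j / ((2 * k + 1 : ℕ) : ℝ) : ℝ) : Circ)

lemma polyM_eq (k : ℕ) (a : Fin (2 * k + 1) → ℝ≥0) (θ : ℝ) :
    polyM (2 * k + 1) a θ = ∑ j, (a j : ℝ≥0∞) • Measure.dirac (ptM k θ j) := rfl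

lemma ptM_coe_eq {k : ℕ} {θ θ' : ℝ} {i j : Fin (2 * k + 1)} (h : ptM k θ i = ptM k θ' j) :
    ∃ m : ℤ, (2 * k + 1 : ℝ) * (θ - θ') =
      2 * Real.pi * ((j : ℤ) - (i : ℤ) + m * (2 * k + 1) : ℤ) := by
  unfold ptM at h
  rw [← sub_eq_zero, ← AddCircle.coe_sub, AddCircle.coe_eq_zero_iff] at h
  obtain ⟨m, hm⟩ := h
  refine ⟨m, ?_⟩
  have hn : (2 * k + 1 : ℝ) ≠ 0 := by positivity
  rw [zsmul_eq_mul] at hm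
  push_cast at hm ⊢
  field_simp at hm
  linarith

lemma ptM_inj (k : ℕ) (θ : ℝ) : Function.Injective (ptM k θ) := by
  intro i j h
  obtain ⟨m, hm⟩ := ptM_coe_eq h
  rw [sub_self, mul_zero, eq_comm, mul_eq_zero] at hm
  have h2 : (2 * Real.pi) ≠ 0 := by positivity
  have hz : ((j : ℤ) - (i : ℤ) + m * (2 * k + 1) : ℤ) = 0 := by
    rcases hm with hm | hm
    · exact absurd hm h2
    · exact_mod_cast hm
  have hi := i.isLt
  have hj := j.isLt
  have hm0 : m = 0 := by
    have hk : (0 : ℤ) ≤ k := by positivity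
    by_contra hne
    rcases lt_or_gt_of_ne hne with h | h
    · have : m ≤ -1 := by omega
      nlinarith
    · have : 1 ≤ m := by omega
      nlinarith
  subst hm0
  ext
  omega

lemma ptM_shift (k : ℕ) (θ : ℝ) (j : Fin (2 * k + 1)) :
    ptM k (θ + 2 * Real.pi / (2 * k + 1)) j = ptM k θ (j + 1) := by
  unfold ptM
  have hn : (2 * k + 1 : ℝ) ≠ 0 := by positivity
  rw [Fin.val_add_one]
  split_ifs with h
  · rw [← sub_eq_zero, ← AddCircle.coe_sub, AddCircle.coe_eq_zero_iff]
    refine ⟨1, ?_⟩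
    subst h
    simp only [Fin.val_last]
    push_cast
    field_simp
    ring
  · congr 1
    push_cast
    field_simp
    ring

lemma polyM_shift (k : ℕ) (a : Fin (2 * k + 1) → ℝ≥0) (θ : ℝ) :
    polyM (2 * k + 1) (fun j => a (j + 1)) (θ + 2 * Real.pi / (2 * k + 1))
      = polyM (2 * k + 1) a θ := by
  rw [polyM_eq, polyM_eq]
  simp_rw [ptM_shift]
  exact Equiv.sum_comp (Equiv.addRight (1 : Fin (2 * k + 1)))
    (fun j => (a j : ℝ≥0∞) • Measure.dirac (ptM k θ j))

lemma polyM_shift_int (k : ℕ) (m : ℤ) : ∀ (a : Fin (2 * k + 1) → ℝ≥0) (θ : ℝ), ∑ j, a j = 1 →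
    ∃ b : Fin (2 * k + 1) → ℝ≥0, ∑ j, b j = 1 ∧
      polyM (2 * k + 1) b (θ + m * (2 * Real.pi / (2 * k + 1))) = polyM (2 * k + 1) a θ := by
  induction m using Int.induction_on with
  | zero => intro a θ h; exact ⟨a, h, by simp⟩
  | succ i ih =>
    intro a θ h
    obtain ⟨b, hb, hb'⟩ := ih a θ h
    refine ⟨fun j => b (j + 1), ?_, ?_⟩
    · rw [← hb]; exact Equiv.sum_comp (Equiv.addRight (1 : Fin (2 * k + 1))) b
    · rw [← hb', ← polyM_shift k b]
      congr 1
      push_cast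
      ring
  | pred i ih =>
    intro a θ h
    obtain ⟨b, hb, hb'⟩ := ih a θ h
    refine ⟨fun j => b (j - 1), ?_, ?_⟩
    · rw [← hb]; exact Equiv.sum_comp (Equiv.subRight (1 : Fin (2 * k + 1))) b
    · rw [← hb', ← polyM_shift k (fun j => b (j - 1))]
      simp only [add_sub_cancel_right]
      congr 1
      push_cast
      ring

lemma polyM_apply_pt (k : ℕ) (a : Fin (2 * k + 1) → ℝ≥0) (θ : ℝ) (i : Fin (2 * k + 1)) :
    polyM (2 * k + 1) a θ {ptM k θ i} = a i := by
  rw [polyM_eq, Measure.finsetSum_apply, Finset.sum_eq_single i]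
  · simp
  · intro j _ hj
    have : ptM k θ j ≠ ptM k θ i := fun h => hj (ptM_inj k θ h)
    simp [this]
  · simp

lemma polyM_apply_ne (k : ℕ) (a : Fin (2 * k + 1) → ℝ≥0) (θ : ℝ) (x : Circ)
    (hx : polyM (2 * k + 1) a θ {x} ≠ 0) : ∃ j, x = ptM k θ j ∧ a j ≠ 0 := by
  by_contra! hc
  apply hx
  rw [polyM_eq, Measure.finsetSum_apply]
  refine Finset.sum_eq_zero fun j _ => ?_
  by_cases h : x = ptM k θ j
  · simp [hc j h]
  · simp [Ne.symm h]

lemma polyM_inj {k : ℕ} {a b : Fin (2 * k + 1) → ℝ≥0} {θ : ℝ}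
    (h : polyM (2 * k + 1) a θ = polyM (2 * k + 1) b θ) : a = b := by
  funext i
  have := polyM_apply_pt k a θ i
  rw [h, polyM_apply_pt] at this
  exact_mod_cast this.symm

lemma polyM_univ (k : ℕ) (a : Fin (2 * k + 1) → ℝ≥0) (θ : ℝ) (h : ∑ j, a j = 1) :
    IsProbabilityMeasure (polyM (2 * k + 1) a θ) := by
  constructor
  rw [polyM_eq, Measure.finsetSum_apply]
  simp only [Measure.smul_apply, measure_univ, smul_eq_mul, mul_one]
  exact_mod_cast h

/-- The coefficients as nonnegative reals. -/
def coefM (k : ℕ) (p : SimplexCyl k) : Fin (2 * k + 1) → ℝ≥0 :=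
  fun j => Real.toNNReal ((p.1 : Fin (2 * k + 1) → ℝ) j)

lemma coefM_coe (k : ℕ) (p : SimplexCyl k) (j : Fin (2 * k + 1)) :
    (coefM k p j : ℝ) = (p.1 : Fin (2 * k + 1) → ℝ) j :=
  Real.coe_toNNReal _ (p.1.2.1 j)

lemma coefM_sum (k : ℕ) (p : SimplexCyl k) : ∑ j, coefM k p j = 1 := by
  apply NNReal.coe_injective
  push_cast
  simp_rw [coefM_coe]
  exact p.1.2.2

/-- The map from the cylinder. -/
def cylMap (k : ℕ) (p : SimplexCyl k) : Pbar k :=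
  ⟨⟨polyM (2 * k + 1) (coefM k p) p.2, polyM_univ k _ _ (coefM_sum k p)⟩,
    coefM k p, p.2, coefM_sum k p, rfl⟩

lemma ptM_continuous (k : ℕ) (j : Fin (2 * k + 1)) : Continuous fun θ => ptM k θ j := by
  unfold ptM
  exact (AddCircle.continuous_mk' _).comp (by fun_prop)

lemma cylMap_continuous (k : ℕ) : Continuous (cylMap k) := by
  rw [continuous_induced_rng]
  rw [continuous_iff_continuousAt]
  intro p
  unfold ContinuousAt
  rw [ProbabilityMeasure.tendsto_iff_forall_integral_tendsto]
  intro f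
  have key : ∀ q : SimplexCyl k, ∫ x, f x ∂(polyM (2 * k + 1) (coefM k q) q.2) =
      ∑ j, (q.1 : Fin (2 * k + 1) → ℝ) j * f (ptM k q.2 j) := by
    intro q
    rw [polyM_eq, integral_finsetSum_measure]
    · refine Finset.sum_congr rfl fun j _ => ?_
      rw [integral_smul_measure, integral_dirac, ENNReal.coe_toReal, coefM_coe, smul_eq_mul]
    · intro j _
      exact (f.integrable _).smul_measure ENNReal.coe_ne_top
  have hc : Continuous fun q : SimplexCyl k =>
      ∑ j, (q.1 : Fin (2 * k + 1) → ℝ) j * f (ptM k q.2 j) := by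
    refine continuous_finset_sum _ fun j _ => ?_
    refine Continuous.mul ((continuous_apply j).comp (continuous_subtype_val.comp continuous_fst)) ?_
    exact f.continuous.comp ((ptM_continuous k j).comp (continuous_subtype_val.comp continuous_snd))
  have ht := hc.tendsto p
  simp_rw [← key] at ht
  exact ht

lemma cylMap_eq_iff {k : ℕ} {p q : SimplexCyl k} : cylMap k p = cylMap k q ↔
    polyM (2 * k + 1) (coefM k p) p.2 = polyM (2 * k + 1) (coefM k q) q.2 := by
  constructor
  · intro h
    exact congrArg (fun μ : Pbar k => (μ : ProbabilityMeasure Circ).toMeasure) h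
  · intro h
    exact Subtype.ext (Subtype.ext h)

lemma cylMap_rel (k : ℕ) (p q : SimplexCyl k) (h : shiftRel k p q) :
    cylMap k p = cylMap k q := by
  obtain ⟨h1, h2, h3⟩ := h
  rw [cylMap_eq_iff, h1, h2]
  have : coefM k q = fun j => coefM k p (j + 1) := by
    funext j
    simp only [coefM, h3]
  rw [this, ← polyM_shift k (coefM k p) 0, zero_add]

lemma coefM_inj {k : ℕ} {p q : SimplexCyl k} (h : coefM k p = coefM k q) : p.1 = q.1 := by
  ext j
  rw [← coefM_coe, ← coefM_coe, h]

lemma rel_of_eq {k : ℕ} {p q : SimplexCyl k} (h0 : (p.2 : ℝ) = 0)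
    (h1 : (q.2 : ℝ) = 2 * Real.pi / (2 * k + 1)) (h : cylMap k p = cylMap k q) :
    shiftRel k p q := by
  refine ⟨h0, h1, ?_⟩
  rw [cylMap_eq_iff, h0, h1, ← polyM_shift k (coefM k p) 0, zero_add] at h
  intro j
  rw [← coefM_coe, ← coefM_coe, ← polyM_inj h]

lemma cylMap_inj (k : ℕ) (p q : SimplexCyl k) (h : cylMap k p = cylMap k q) :
    Quot.mk (shiftRel k) p = Quot.mk (shiftRel k) q := by
  have hp := h
  rw [cylMap_eq_iff] at h
  have hn : (0 : ℝ) < 2 * k + 1 := by positivity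
  have hpi := Real.pi_pos
  obtain ⟨i, hi⟩ : ∃ i, coefM k p i ≠ 0 := by
    by_contra! hc
    have := coefM_sum k p
    simp [hc] at this
  have hne : polyM (2 * k + 1) (coefM k q) q.2 {ptM k p.2 i} ≠ 0 := by
    rw [← h, polyM_apply_pt]
    exact_mod_cast hi
  obtain ⟨j, hj, -⟩ := polyM_apply_ne _ _ _ _ hne
  obtain ⟨m, hm⟩ := ptM_coe_eq hj
  set z : ℤ := (j : ℤ) - (i : ℤ) + m * (2 * k + 1) with hz
  clear_value z
  have hp0 := p.2.2.1
  have hp1 := p.2.2.2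
  have hq0 := q.2.2.1
  have hq1 := q.2.2.2
  rw [le_div_iff₀ hn] at hp1 hq1
  have hp0' : 0 ≤ (p.2 : ℝ) * (2 * k + 1) := by positivity
  have hq0' : 0 ≤ (q.2 : ℝ) * (2 * k + 1) := by positivity
  have hzle : z ≤ 1 := by
    have : (z : ℝ) ≤ 1 := by nlinarith
    exact_mod_cast this
  have hzge : -1 ≤ z := by
    have : (-1 : ℝ) ≤ z := by nlinarith
    exact_mod_cast this
  obtain rfl | rfl | rfl : z = 0 ∨ z = 1 ∨ z = -1 := by omega
  · have he : (p.2 : ℝ) = q.2 := by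
      simp only [Int.cast_zero, mul_zero, mul_eq_zero] at hm
      rcases hm with hm | hm
      · linarith
      · linarith
    rw [he] at h
    rw [show p = q from Prod.ext (coefM_inj (polyM_inj h)) (Subtype.ext he)]
  · push_cast at hm
    have hq : (q.2 : ℝ) = 0 := by
      have : (q.2 : ℝ) * (2 * k + 1) = 0 := by linarith
      rcases mul_eq_zero.1 this with h | h <;> linarith
    have hpp : (p.2 : ℝ) = 2 * Real.pi / (2 * k + 1) := by
      rw [eq_div_iff hn.ne']; linarith
    exact (Quot.sound (rel_of_eq hq hpp hp.symm)).symm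
  · push_cast at hm
    have hq : (p.2 : ℝ) = 0 := by
      have : (p.2 : ℝ) * (2 * k + 1) = 0 := by linarith
      rcases mul_eq_zero.1 this with h | h <;> linarith
    have hpp : (q.2 : ℝ) = 2 * Real.pi / (2 * k + 1) := by
      rw [eq_div_iff hn.ne']; linarith
    exact Quot.sound (rel_of_eq hq hpp hp)

lemma cylMap_surj (k : ℕ) : Function.Surjective (cylMap k) := by
  rintro ⟨μ, a, θ, ha, hμ⟩
  have hpos : (0 : ℝ) < 2 * Real.pi / (2 * k + 1) := by positivity
  set c : ℝ := 2 * Real.pi / (2 * k + 1) with hc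
  obtain ⟨b, hb, hb'⟩ := polyM_shift_int k (-⌊θ / c⌋) a θ ha
  rw [← hc] at hb'
  have h1 := Int.floor_le (θ / c)
  have h2 := (Int.lt_floor_add_one (θ / c)).le
  rw [le_div_iff₀ hpos] at h1
  rw [div_le_iff₀ hpos] at h2
  have hmem : θ + ((-⌊θ / c⌋ : ℤ) : ℝ) * c ∈ Set.Icc (0 : ℝ) c := by
    push_cast
    constructor <;> linarith
  have hbR : ∑ j, (b j : ℝ) = 1 := by exact_mod_cast hb
  refine ⟨⟨⟨fun j => (b j : ℝ), fun j => (b j).2, hbR⟩, ⟨_, hmem⟩⟩, ?_⟩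
  refine Subtype.ext (Subtype.ext ?_)
  refine Eq.trans ?_ hμ.symm
  rw [← hb']
  refine congrArg (fun a => polyM (2 * k + 1) a _) ?_
  funext j
  exact Real.toNNReal_coe

lemma bdry_iff (k : ℕ) (p : SimplexCyl k) :
    (cylMap k p : ProbabilityMeasure Circ) ∈ PbarBdry k ↔
      ∃ j, (p.1 : Fin (2 * k + 1) → ℝ) j = 0 := by
  constructor
  · rintro ⟨b, θ, hb, ⟨j0, hj0⟩, h⟩
    by_contra! hc
    have h' : polyM (2 * k + 1) (coefM k p) p.2 = polyM (2 * k + 1) b θ := h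
    have hex : ∀ i, ∃ j, ptM k p.2 i = ptM k θ j ∧ b j ≠ 0 := by
      intro i
      apply polyM_apply_ne
      rw [← h', polyM_apply_pt]
      intro h0
      apply hc i
      rw [← coefM_coe]
      exact_mod_cast h0
    choose f hf hf' using hex
    have hinj : Function.Injective f := by
      intro i i' hii
      apply ptM_inj k p.2
      rw [hf, hf, hii]
    obtain ⟨i, hi⟩ := (Finite.injective_iff_surjective.1 hinj) j0
    exact hf' i (hi ▸ hj0)
  · rintro ⟨j, hj⟩
    exact ⟨coefM k p, p.2, coefM_sum k p, ⟨j, by simp [coefM, hj]⟩, rfl⟩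

/-- The map `[(a_0,…,a_{2k}), θ] ↦ Σ_j a_j δ_{θ+2πj/(2k+1)}` descends to a homeomorphism
from `(Δ^{2k} × [0, 2π/(2k+1)])/∼` onto `P̄_{2k+1}`, restricting to a homeomorphism from
`(∂Δ^{2k} × [0, 2π/(2k+1)])/∼` onto `∂P_{2k+1}`. -/
theorem mapping_torus_homeomorph_Pbar (k : ℕ) :
    ∃ φ : Quot (shiftRel k) ≃ₜ ↥(Pbar k),
      (∀ p : SimplexCyl k,
        ((φ (Quot.mk _ p) : ProbabilityMeasure Circ)).toMeasure
          = polyM (2 * k + 1) (fun j => Real.toNNReal ((p.1 : Fin (2 * k + 1) → ℝ) j))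
              (p.2 : ℝ)) ∧
      (∀ p : SimplexCyl k,
        ((φ (Quot.mk _ p) : ProbabilityMeasure Circ) ∈ PbarBdry k ↔
          ∃ j, (p.1 : Fin (2 * k + 1) → ℝ) j = 0)) := by
  have hbij : Function.Bijective (Quot.lift (cylMap k) (cylMap_rel k)) := by
    constructor
    · rintro ⟨p⟩ ⟨q⟩ h
      exact cylMap_inj k p q h
    · intro μ
      obtain ⟨p, hp⟩ := cylMap_surj k μ
      exact ⟨Quot.mk _ p, hp⟩
  have hcont : Continuous (Equiv.ofBijective _ hbij) :=
    continuous_quot_lift _ (cylMap_continuous k)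
  exact ⟨hcont.homeoOfEquivCompactToT2, fun p => rfl, fun p => bdry_iff k p⟩
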